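/- arXiv:1912.05835 — 2 statements merged into one kernel-verified Lean document; each statement's English description precedes it below -/
import Mathlib

section
/- (Relative entropy lower bound, part (I).) Let ê : ℝ¹⁹×[0,∞) → ℝ (with ξ = (F,ζ,w) ∈ M₃(ℝ)×M₃(ℝ)×ℝ) be C³, uniformly convex (∇²_{(ξ,η)}ê ≥ c𝕀 for some c > 0), and satisfy the growth conditions (G1)–(G3) with exponents p ≥ 4, q ≥ 2, ρ > 1, ℓ > 1. Then for every M > 0 there exist R = R(M) > 0 and constants K₁ = K₁(M,c) > 0, K₂ = K₂(M,c) > 0 such that for all (F,v,η) ∈ M₃(ℝ)×ℝ³×[0,∞) and all (F̄,v̄,η̄) ∈ Γ_M: if |F|^p + η^ℓ + |v|² > R then I(v,Φ(F),η | v̄,Φ(F̄),η̄) ≥ (K₁/2)(|F|^p + η^ℓ + |v|²), and if |F|^p + η^ℓ + |v|² ≤ R then I(v,Φ(F),η | v̄,Φ(F̄),η̄) ≥ K₂( |Φ(F) − Φ(F̄)|² + |η − η̄|² + |v − v̄|² ). -/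
open scoped BigOperators
noncomputable section

/-- 3×3 real matrices, modelled as `Fin 3 → Fin 3 → ℝ`. -/
abbrev Mat : Type := Fin 3 → Fin 3 → ℝ

/-- The Levi-Civita symbol on `{0,1,2}`. -/
def lc (i j k : Fin 3) : ℝ :=
  (((j : ℕ) : ℝ) - ((i : ℕ) : ℝ)) * (((k : ℕ) : ℝ) - ((i : ℕ) : ℝ)) *
    (((k : ℕ) : ℝ) - ((j : ℕ) : ℝ)) / 2

/-- The cofactor matrix `(cof F)_{iα} = (1/2) Σ ε_{ijk} ε_{αβγ} F_{jβ} F_{kγ}`. -/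
def cof (F : Mat) : Mat := fun i α =>
  (1 / 2) * ∑ j, ∑ k, ∑ β, ∑ γ, lc i j k * lc α β γ * F j β * F k γ

/-- The determinant `det F = (1/6) Σ ε_{ijk} ε_{αβγ} F_{iα} F_{jβ} F_{kγ}`. -/
def mdet (F : Mat) : ℝ :=
  (1 / 6) * ∑ i, ∑ j, ∑ k, ∑ α, ∑ β, ∑ γ, lc i j k * lc α β γ * F i α * F j β * F k γ

/-- Frobenius norm of a 3×3 matrix. -/
def frob (F : Mat) : ℝ := Real.sqrt (∑ i, ∑ j, F i j ^ 2)

/-- The extended state space `ξ = (F, ζ, w) ∈ M₃(ℝ) × M₃(ℝ) × ℝ ≅ ℝ¹⁹`. -/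
abbrev Xi : Type := Mat × Mat × ℝ

/-- Extended state together with the entropy: `(ξ, η) ∈ ℝ¹⁹ × ℝ`. -/
abbrev XE : Type := Xi × ℝ

/-- The natural domain `{η ≥ 0}` of the internal energy. -/
def Dom : Set XE := {x | 0 ≤ x.2}

/-- The null-Lagrangian vector `Φ(F) = (F, cof F, det F)`. -/
def Phi (F : Mat) : Xi := (F, cof F, mdet F)

/-- Directional derivative of `eh` at `x` in the pure-`ξ` direction `d`
(equivalently `Σ_B (∂eh/∂ξ^B)(x) d^B`), taken within the domain `{η ≥ 0}`. -/
def dXi (eh : XE → ℝ) (x : XE) (d : Xi) : ℝ :=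
  fderivWithin ℝ eh Dom x (d, 0)

/-- `θ̂ = ∂eh/∂η`, taken within the domain `{η ≥ 0}`. -/
def dEta (eh : XE → ℝ) (x : XE) : ℝ :=
  fderivWithin ℝ eh Dom x (0, 1)

/-- Matrix of partial derivatives `∂eh/∂F`. -/
def dFmat (eh : XE → ℝ) (x : XE) : Mat :=
  fun i j => dXi eh x (Pi.single i (Pi.single j 1), 0, 0)

/-- Matrix of partial derivatives `∂eh/∂ζ`. -/
def dZmat (eh : XE → ℝ) (x : XE) : Mat :=
  fun i j => dXi eh x (0, Pi.single i (Pi.single j 1), 0)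

/-- Partial derivative `∂eh/∂w`. -/
def dW (eh : XE → ℝ) (x : XE) : ℝ := dXi eh x (0, 0, 1)

/-- Second directional derivative of `eh` at `x`, in directions `u` (outer) and
`d` (inner), within the domain `{η ≥ 0}`. -/
def d2 (eh : XE → ℝ) (x : XE) (u d : XE) : ℝ :=
  fderivWithin ℝ (fun y => fderivWithin ℝ eh Dom y d) Dom x u

/-- The weight `|F|^p + |ζ|^q + |w|^ρ + |η|^ℓ` appearing in the growth conditions. -/
def bigN (p q ρ ℓ : ℝ) (x : XE) : ℝ :=
  frob x.1.1 ^ p + frob x.1.2.1 ^ q + |x.1.2.2| ^ ρ + |x.2| ^ ℓ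

/-- Uniform convexity `∇²_{(ξ,η)} eh ≥ c 𝕀` (as quadratic forms, with the Euclidean
norm on `ℝ¹⁹ × ℝ`). -/
def UnifConvex (eh : XE → ℝ) (c : ℝ) : Prop :=
  ∀ x ∈ Dom, ∀ d : XE,
    c * (frob d.1.1 ^ 2 + frob d.1.2.1 ^ 2 + d.1.2.2 ^ 2 + d.2 ^ 2) ≤ d2 eh x d d

/-- Growth condition (G1): `c N(ξ,η) - c ≤ eh(ξ,η) ≤ c N(ξ,η) + c`. -/
def GrowthG1 (eh : XE → ℝ) (c p q ρ ℓ : ℝ) : Prop :=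
  ∀ x ∈ Dom, c * bigN p q ρ ℓ x - c ≤ eh x ∧ eh x ≤ c * bigN p q ρ ℓ x + c

/-- Growth condition (G2): `∂_η eh / N → 0` as `N → ∞`. -/
def GrowthG2 (eh : XE → ℝ) (p q ρ ℓ : ℝ) : Prop :=
  ∀ ε > (0:ℝ), ∃ R : ℝ, ∀ x ∈ Dom, R ≤ bigN p q ρ ℓ x → |dEta eh x| ≤ ε * bigN p q ρ ℓ x

/-- Growth condition (G3):
`|∂_F eh|^{p/(p-1)} + |∂_ζ eh|^{p/(p-2)} + |∂_w eh|^{p/(p-3)} ≤ c N + c`. -/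
def GrowthG3 (eh : XE → ℝ) (c p q ρ ℓ : ℝ) : Prop :=
  ∀ x ∈ Dom,
    frob (dFmat eh x) ^ (p / (p-1)) + frob (dZmat eh x) ^ (p / (p-2))
      + |dW eh x| ^ (p / (p-3)) ≤ c * bigN p q ρ ℓ x + c

/-- The relative internal energy
`eh(ξ,η | ξ̄,η̄) = eh(ξ,η) − eh(ξ̄,η̄) − ∇_ξ eh(ξ̄,η̄)·(ξ−ξ̄) − ∂_η eh(ξ̄,η̄)(η−η̄)`. -/
def erel (eh : XE → ℝ) (x xb : XE) : ℝ :=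
  eh x - eh xb - dXi eh xb (x.1 - xb.1) - dEta eh xb * (x.2 - xb.2)

/-- The relative total energy `I(v,ξ,η | v̄,ξ̄,η̄) = ½|v−v̄|² + eh(ξ,η|ξ̄,η̄)`. -/
def relI (eh : XE → ℝ) (v vb : Fin 3 → ℝ) (x xb : XE) : ℝ :=
  (1/2) * (∑ i, (v i - vb i)^2) + erel eh x xb

/-- The compact set `Γ_M = {(F̄,v̄,η̄) : |F̄| ≤ M, |v̄| ≤ M, 0 ≤ η̄ ≤ M}`. -/
def Gam (M : ℝ) (Fb : Mat) (vb : Fin 3 → ℝ) (ηb : ℝ) : Prop :=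
  frob Fb ≤ M ∧ Real.sqrt (∑ i, (vb i)^2) ≤ M ∧ 0 ≤ ηb ∧ ηb ≤ M

/-- `|Φ(F) − Φ(F̄)|²` (squared Euclidean distance of the null-Lagrangian vectors). -/
def phidist (F Fb : Mat) : ℝ :=
  frob (F - Fb) ^ 2 + frob (cof F - cof Fb) ^ 2 + (mdet F - mdet Fb) ^ 2

theorem convex_Dom : Convex ℝ Dom := by
  intro x hx y hy a b ha hb _
  change 0 ≤ x.2 at hx
  change 0 ≤ y.2 at hy
  change 0 ≤ a * x.2 + b * y.2
  positivity

theorem uniqueDiffOn_Dom : UniqueDiffOn ℝ Dom := by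
  refine uniqueDiffOn_convex convex_Dom ⟨((0 : Xi), (1 : ℝ)), ?_⟩
  refine mem_interior.mpr ⟨{x : XE | 0 < x.2}, fun x hx => le_of_lt (show 0 < x.2 from hx), ?_, ?_⟩
  · exact isOpen_lt continuous_const continuous_snd
  · simp

theorem dXi_add_dEta (eh : XE → ℝ) (x : XE) (d : XE) :
    dXi eh x d.1 + dEta eh x * d.2 = fderivWithin ℝ eh Dom x d := by
  have h : d = (d.1, (0 : ℝ)) + d.2 • ((0 : Xi), (1 : ℝ)) := by
    ext <;> simp
  conv_rhs => rw [h, map_add, map_smul]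
  simp [dXi, dEta, mul_comm]

theorem erel_eq (eh : XE → ℝ) (x xb : XE) :
    erel eh x xb = eh x - eh xb - fderivWithin ℝ eh Dom xb (x - xb) := by
  rw [← dXi_add_dEta, erel]
  simp only [Prod.fst_sub, Prod.snd_sub]
  ring

/-- Second-order Taylor lower bound on `[0, 1]`. -/
theorem taylor_lower_bound {g g' g'' : ℝ → ℝ} {k : ℝ}
    (hg : ∀ t ∈ Set.Icc (0 : ℝ) 1, HasDerivWithinAt g (g' t) (Set.Icc 0 1) t)
    (hg' : ∀ t ∈ Set.Icc (0 : ℝ) 1, HasDerivWithinAt g' (g'' t) (Set.Icc 0 1) t)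
    (hk : ∀ t ∈ Set.Icc (0 : ℝ) 1, k ≤ g'' t) :
    k / 2 ≤ g 1 - g 0 - g' 0 := by
  have h0 : (0 : ℝ) ∈ Set.Icc (0 : ℝ) 1 := by simp
  have h1 : (1 : ℝ) ∈ Set.Icc (0 : ℝ) 1 := by simp
  have hd1 : ∀ t ∈ Set.Icc (0 : ℝ) 1,
      HasDerivWithinAt (fun t => g' t - k * t) (g'' t - k) (Set.Icc 0 1) t := fun t ht => by
    refine ((hg' t ht).sub ((hasDerivWithinAt_id t _).const_mul k)).congr_deriv ?_
    simp
  have hm1 : MonotoneOn (fun t => g' t - k * t) (Set.Icc 0 1) :=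
    monotoneOn_of_hasDerivWithinAt_nonneg (convex_Icc 0 1)
      (fun t ht => (hd1 t ht).continuousWithinAt)
      (fun t ht => (hd1 t (interior_subset ht)).mono interior_subset)
      (fun t ht => sub_nonneg.mpr (hk t (interior_subset ht)))
  have hd2 : ∀ t ∈ Set.Icc (0 : ℝ) 1,
      HasDerivWithinAt (fun t => g t - g' 0 * t - k / 2 * t ^ 2)
        (g' t - g' 0 - k * t) (Set.Icc 0 1) t := fun t ht => by
    have := ((hg t ht).sub ((hasDerivWithinAt_id t _).const_mul (g' 0))).sub
      (((hasDerivWithinAt_id t (Set.Icc 0 1)).pow 2).const_mul (k / 2))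
    refine this.congr_deriv ?_
    simp
    ring
  have hm2 : MonotoneOn (fun t => g t - g' 0 * t - k / 2 * t ^ 2) (Set.Icc 0 1) :=
    monotoneOn_of_hasDerivWithinAt_nonneg (convex_Icc 0 1)
      (fun t ht => (hd2 t ht).continuousWithinAt)
      (fun t ht => (hd2 t (interior_subset ht)).mono interior_subset)
      (fun t ht => by
        have ht' := interior_subset ht
        have := hm1 h0 ht' ht'.1
        simp only at this
        linarith)
  have := hm2 h0 h1 zero_le_one
  norm_num at this
  linarith

/-- Uniform convexity bounds the relative energy below by the squared distance. -/
theorem UnifConvex.le_erel {eh : XE → ℝ} {c : ℝ} (hconv : UnifConvex eh c)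
    (hC : ContDiffOn ℝ 2 eh Dom) {x xb : XE} (hx : x ∈ Dom) (hxb : xb ∈ Dom) :
    c / 2 * (frob (x.1.1 - xb.1.1) ^ 2 + frob (x.1.2.1 - xb.1.2.1) ^ 2
      + (x.1.2.2 - xb.1.2.2) ^ 2 + (x.2 - xb.2) ^ 2) ≤ erel eh x xb := by
  set d : XE := x - xb with hd
  let γ : ℝ → XE := fun t => xb + t • d
  have hγ : ∀ t ∈ Set.Icc (0 : ℝ) 1, γ t ∈ Dom := fun t ht =>
    convex_Dom.add_smul_sub_mem hxb hx ht
  have hγ' : ∀ t, HasDerivWithinAt γ d (Set.Icc 0 1) t := fun t => by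
    refine (((hasDerivAt_id t).smul_const d).const_add xb).hasDerivWithinAt.congr_deriv ?_
    simp
  have hD : ∀ y ∈ Dom, HasFDerivWithinAt eh (fderivWithin ℝ eh Dom y) Dom y := fun y hy =>
    (hC.differentiableOn (by norm_num) y hy).hasFDerivWithinAt
  have hC1 : ContDiffOn ℝ 1 (fderivWithin ℝ eh Dom) Dom :=
    hC.fderivWithin uniqueDiffOn_Dom (by norm_num)
  have hC1d : DifferentiableOn ℝ (fun y => fderivWithin ℝ eh Dom y d) Dom :=
    (hC1.differentiableOn (by norm_num)).clm_apply (differentiableOn_const d)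
  have key := taylor_lower_bound (g := fun t => eh (γ t))
    (g' := fun t => fderivWithin ℝ eh Dom (γ t) d) (g'' := fun t => d2 eh (γ t) d d)
    (k := c * (frob d.1.1 ^ 2 + frob d.1.2.1 ^ 2 + d.1.2.2 ^ 2 + d.2 ^ 2))
    (fun t ht => (hD _ (hγ t ht)).comp_hasDerivWithinAt t (hγ' t) hγ)
    (fun t ht => (hC1d _ (hγ t ht)).hasFDerivWithinAt.comp_hasDerivWithinAt t (hγ' t) hγ)
    (fun t ht => hconv _ (hγ t ht) d)
  have e0 : γ 0 = xb := by simp [γ]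
  have e1 : γ 1 = x := by simp [γ, hd]
  simp only [e0, e1] at key
  rw [erel_eq]
  refine le_trans (le_of_eq ?_) key
  simp only [hd, Prod.fst_sub, Prod.snd_sub]
  ring

/-- A superlinear power absorbs a linear term up to a constant. -/
theorem exists_mul_le_mul_rpow_add {s ε C : ℝ} (hs : 1 < s) (hε : 0 < ε) (hC : 0 ≤ C) :
    ∃ B, 0 ≤ B ∧ ∀ a : ℝ, 0 ≤ a → C * a ≤ ε * a ^ s + B := by
  obtain ⟨A, hA⟩ := Filter.eventually_atTop.mp
    ((tendsto_rpow_atTop (sub_pos.mpr hs)).eventually_ge_atTop (C / ε))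
  refine ⟨C * max A 1, by positivity, fun a ha => ?_⟩
  rcases le_total a (max A 1) with h | h
  · have : 0 ≤ ε * a ^ s := by positivity
    have := mul_le_mul_of_nonneg_left h hC
    linarith
  · have ha0 : 0 < a := lt_of_lt_of_le one_pos ((le_max_right _ _).trans h)
    have h1 := hA a ((le_max_left _ _).trans h)
    rw [div_le_iff₀ hε] at h1
    have h2 : a ^ s = a ^ (s - 1) * a := by
      rw [← Real.rpow_add_one ha0.ne', sub_add_cancel]
    have h3 := mul_le_mul_of_nonneg_right h1 ha
    have : 0 ≤ C * max A 1 := by positivity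
    rw [h2]
    linarith

theorem frob_nonneg (F : Mat) : 0 ≤ frob F := Real.sqrt_nonneg _

theorem norm_le_frob (F : Mat) : ‖F‖ ≤ frob F := by
  refine (pi_norm_le_iff_of_nonneg (frob_nonneg F)).mpr fun i =>
    (pi_norm_le_iff_of_nonneg (frob_nonneg F)).mpr fun j => Real.abs_le_sqrt ?_
  calc F i j ^ 2 ≤ ∑ j, F i j ^ 2 :=
        Finset.single_le_sum (f := fun j => F i j ^ 2) (fun _ _ => sq_nonneg _) (Finset.mem_univ j)
    _ ≤ ∑ i, ∑ j, F i j ^ 2 :=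
        Finset.single_le_sum (f := fun i => ∑ j, F i j ^ 2)
          (fun _ _ => Finset.sum_nonneg fun _ _ => sq_nonneg _) (Finset.mem_univ i)

theorem norm_XE_le (x : XE) : ‖x‖ ≤ frob x.1.1 + frob x.1.2.1 + |x.1.2.2| + |x.2| := by
  have h1 := norm_le_frob x.1.1
  have h2 := norm_le_frob x.1.2.1
  have := frob_nonneg x.1.1
  have := frob_nonneg x.1.2.1
  have := abs_nonneg x.1.2.2
  have := abs_nonneg x.2
  simp only [Prod.norm_def, Real.norm_eq_abs, sup_le_iff]
  refine ⟨⟨?_, ?_, ?_⟩, ?_⟩ <;> linarith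

theorem continuous_Phi : Continuous Phi := by
  unfold Phi cof mdet
  fun_prop

/-- On the states coming from `Γ_M` the energy, its gradient and the state are bounded. -/
theorem exists_bound_of_Gam {eh : XE → ℝ} (hC : ContDiffOn ℝ 1 eh Dom) (M : ℝ) :
    ∃ C, 0 ≤ C ∧ ∀ (Fb : Mat) (ηb : ℝ), frob Fb ≤ M → 0 ≤ ηb → ηb ≤ M →
      |eh (Phi Fb, ηb)| ≤ C ∧ ‖fderivWithin ℝ eh Dom (Phi Fb, ηb)‖ ≤ C ∧
        ‖((Phi Fb, ηb) : XE)‖ ≤ C := by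
  let S : Set XE := (fun y : Mat × ℝ => (Phi y.1, y.2)) ''
    (Metric.closedBall 0 M ×ˢ Set.Icc 0 M)
  have hS : IsCompact S := ((isCompact_closedBall _ _).prod isCompact_Icc).image
    ((continuous_Phi.comp continuous_fst).prodMk continuous_snd)
  have hSD : S ⊆ Dom := by
    rintro _ ⟨y, hy, rfl⟩
    exact hy.2.1
  obtain ⟨C₁, h₁⟩ := hS.exists_bound_of_continuousOn (hC.continuousOn.mono hSD)
  obtain ⟨C₂, h₂⟩ := hS.exists_bound_of_continuousOn
    ((hC.continuousOn_fderivWithin uniqueDiffOn_Dom le_rfl).mono hSD)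
  obtain ⟨C₃, h₃⟩ := hS.exists_bound_of_continuousOn continuousOn_id
  refine ⟨max 0 (max C₁ (max C₂ C₃)), le_max_left _ _, fun Fb ηb hF h0 hM => ?_⟩
  have hmem : ((Phi Fb, ηb) : XE) ∈ S :=
    ⟨(Fb, ηb), ⟨by simpa using (norm_le_frob Fb).trans hF, h0, hM⟩, rfl⟩
  exact ⟨(h₁ _ hmem).trans (by simp), (h₂ _ hmem).trans (by simp), (h₃ _ hmem).trans (by simp)⟩

/-- Coercivity of the relative energy, uniformly over the states coming from `Γ_M`. -/
theorem GrowthG1.exists_le_erel {eh : XE → ℝ} {cg p q ρ ℓ : ℝ}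
    (hG1 : GrowthG1 eh cg p q ρ ℓ) (hC : ContDiffOn ℝ 1 eh Dom) (hcg : 0 < cg)
    (hp : 1 < p) (hq : 1 < q) (hρ : 1 < ρ) (hℓ : 1 < ℓ) (M : ℝ) :
    ∃ B, 0 ≤ B ∧ ∀ (x : XE) (Fb : Mat) (ηb : ℝ), x ∈ Dom → frob Fb ≤ M → 0 ≤ ηb → ηb ≤ M →
      cg / 2 * bigN p q ρ ℓ x - B ≤ erel eh x (Phi Fb, ηb) := by
  obtain ⟨C, hC0, hCb⟩ := exists_bound_of_Gam hC M
  have hε : 0 < cg / 2 := half_pos hcg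
  obtain ⟨B₁, hB₁, h₁⟩ := exists_mul_le_mul_rpow_add hp hε hC0
  obtain ⟨B₂, hB₂, h₂⟩ := exists_mul_le_mul_rpow_add hq hε hC0
  obtain ⟨B₃, hB₃, h₃⟩ := exists_mul_le_mul_rpow_add hρ hε hC0
  obtain ⟨B₄, hB₄, h₄⟩ := exists_mul_le_mul_rpow_add hℓ hε hC0
  refine ⟨cg + C + C * C + (B₁ + B₂ + B₃ + B₄), by positivity, fun x Fb ηb hx hF h0 hM => ?_⟩
  obtain ⟨he, hD, hn⟩ := hCb Fb ηb hF h0 hM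
  set xb : XE := (Phi Fb, ηb)
  have hlin : fderivWithin ℝ eh Dom xb (x - xb) ≤ C * ‖x‖ + C * C := by
    calc fderivWithin ℝ eh Dom xb (x - xb)
        ≤ ‖fderivWithin ℝ eh Dom xb (x - xb)‖ := Real.le_norm_self _
      _ ≤ ‖fderivWithin ℝ eh Dom xb‖ * ‖x - xb‖ := ContinuousLinearMap.le_opNorm _ _
      _ ≤ C * (‖x‖ + C) := by
          gcongr
          exact (norm_sub_le _ _).trans (by gcongr)
      _ = C * ‖x‖ + C * C := by ring
  have hx' := mul_le_mul_of_nonneg_left (norm_XE_le x) hC0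
  have g₁ := h₁ _ (frob_nonneg x.1.1)
  have g₂ := h₂ _ (frob_nonneg x.1.2.1)
  have g₃ := h₃ _ (abs_nonneg x.1.2.2)
  have g₄ := h₄ _ (abs_nonneg x.2)
  have hlow := (hG1 x hx).1
  have := (le_abs_self _).trans he
  rw [erel_eq]
  unfold bigN at hlow ⊢
  linarith

theorem half_sum_sq_sub_le {ι : Type*} [Fintype ι] (v w : ι → ℝ) :
    (1 / 2) * ∑ i, v i ^ 2 - ∑ i, w i ^ 2 ≤ ∑ i, (v i - w i) ^ 2 := by
  rw [Finset.mul_sum, ← Finset.sum_sub_distrib]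
  refine Finset.sum_le_sum fun i _ => ?_
  nlinarith [sq_nonneg (v i - 2 * w i)]

/-- relative entropy lower bound, part (I).  Under uniform convexity
and the growth conditions (G1)–(G3), for every `M > 0` there are `R > 0` and
`K₁, K₂ > 0` such that for all states `(F,v,η)` and all `(F̄,v̄,η̄) ∈ Γ_M`:
if `|F|^p + η^ℓ + |v|² > R` then `I(v,Φ(F),η|v̄,Φ(F̄),η̄) ≥ (K₁/2)(|F|^p + η^ℓ + |v|²)`,
and otherwise `I ≥ K₂(|Φ(F)−Φ(F̄)|² + |η−η̄|² + |v−v̄|²)`. -/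
theorem relative_entropy_lower_bound_I
    (c cg p q ρ ℓ : ℝ) (eh : XE → ℝ)
    (hc : 0 < c) (hcg : 0 < cg)
    (hp : 4 ≤ p) (hq : 2 ≤ q) (hρ : 1 < ρ) (hℓ : 1 < ℓ)
    (hC3 : ContDiffOn ℝ 3 eh Dom)
    (hconv : UnifConvex eh c)
    (hG1 : GrowthG1 eh cg p q ρ ℓ)
    (hG2 : GrowthG2 eh p q ρ ℓ)
    (hG3 : GrowthG3 eh cg p q ρ ℓ)
    :
    ∀ M > (0:ℝ), ∃ R > (0:ℝ), ∃ K₁ > (0:ℝ), ∃ K₂ > (0:ℝ),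
      ∀ (F Fb : Mat) (v vb : Fin 3 → ℝ) (η ηb : ℝ),
        0 ≤ η → Gam M Fb vb ηb →
        (frob F ^ p + η ^ ℓ + (∑ i, (v i)^2) > R →
          K₁ / 2 * (frob F ^ p + η ^ ℓ + (∑ i, (v i)^2))
            ≤ relI eh v vb (Phi F, η) (Phi Fb, ηb))
        ∧ (frob F ^ p + η ^ ℓ + (∑ i, (v i)^2) ≤ R →
          K₂ * (phidist F Fb + (η - ηb)^2 + (∑ i, (v i - vb i)^2))
            ≤ relI eh v vb (Phi F, η) (Phi Fb, ηb)) := by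
  intro M hM
  obtain ⟨B, hB, hlow⟩ := hG1.exists_le_erel (hC3.of_le (by norm_num)) hcg
    (by linarith) (by linarith) hρ hℓ M
  set m : ℝ := min (cg / 2) (1 / 4)
  have hm0 : 0 < m := lt_min (half_pos hcg) (by norm_num)
  set A : ℝ := B + M ^ 2 / 2 with hAB
  have hA : 0 ≤ A := by positivity
  refine ⟨2 * A / m + 1, by positivity, m, hm0, min (1 / 2) (c / 2),
    lt_min (by norm_num) (half_pos hc), fun F Fb v vb η ηb hη hΓ => ⟨fun hR => ?_, fun _ => ?_⟩⟩
  · obtain ⟨hF, hv, h0, hηM⟩ := hΓ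
    have hvb : ∑ i, vb i ^ 2 ≤ M ^ 2 := (Real.sqrt_le_left hM.le).mp hv
    have h1 := hlow (Phi F, η) Fb ηb hη hF h0 hηM
    have h2 := half_sum_sq_sub_le v vb
    have hN : frob F ^ p + η ^ ℓ ≤ bigN p q ρ ℓ (Phi F, η) := by
      have : 0 ≤ frob (cof F) ^ q := Real.rpow_nonneg (frob_nonneg _) _
      have : 0 ≤ |mdet F| ^ ρ := Real.rpow_nonneg (abs_nonneg _) _
      simp only [bigN, Phi, abs_of_nonneg hη]
      linarith
    have hT : 0 ≤ frob F ^ p + η ^ ℓ :=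
      add_nonneg (Real.rpow_nonneg (frob_nonneg _) _) (Real.rpow_nonneg hη _)
    have hV : 0 ≤ ∑ i, v i ^ 2 := Finset.sum_nonneg fun _ _ => sq_nonneg _
    have h3 : m * (frob F ^ p + η ^ ℓ) ≤ cg / 2 * bigN p q ρ ℓ (Phi F, η) :=
      mul_le_mul (min_le_left _ _) hN hT (half_pos hcg).le
    have h4 : m * ∑ i, v i ^ 2 ≤ 1 / 4 * ∑ i, v i ^ 2 :=
      mul_le_mul_of_nonneg_right (min_le_right _ _) hV
    have h5 : 2 * A ≤ m * (frob F ^ p + η ^ ℓ + ∑ i, v i ^ 2) := by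
      rw [mul_comm m, ← div_le_iff₀ hm0]
      linarith
    unfold relI
    linarith
  · have h1 := hconv.le_erel (hC3.of_le (by norm_num)) (x := (Phi F, η)) (xb := (Phi Fb, ηb))
      hη hΓ.2.2.1
    have h2 : min (1 / 2) (c / 2) * (phidist F Fb + (η - ηb) ^ 2)
        ≤ c / 2 * (phidist F Fb + (η - ηb) ^ 2) :=
      mul_le_mul_of_nonneg_right (min_le_right _ _) (by unfold phidist; positivity)
    have h3 : min (1 / 2) (c / 2) * ∑ i, (v i - vb i) ^ 2 ≤ 1 / 2 * ∑ i, (v i - vb i) ^ 2 :=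
      mul_le_mul_of_nonneg_right (min_le_left _ _) (Finset.sum_nonneg fun _ _ => sq_nonneg _)
    rw [mul_add]
    exact (add_le_add h2 h3).trans (by rw [relI, add_comm]; exact add_le_add le_rfl h1)
end
end

section
/- (Relative entropy estimate, part (II), stress–null-Lagrangian cross term.) Let ê : ℝ¹⁹×[0,∞) → ℝ (with ξ = (F,ζ,w) ∈ M₃(ℝ)×M₃(ℝ)×ℝ) be C³, uniformly convex (∇²_{(ξ,η)}ê ≥ c𝕀 for some c > 0), and satisfy the growth conditions (G1)–(G3) with exponents p ≥ 4, q ≥ 2, ρ > 1, ℓ > 1. Then for every M > 0 there is a constant C₁ > 0 such that for all (F,v,η) ∈ M₃(ℝ)×ℝ³×[0,∞), all (F̄,v̄,η̄) ∈ Γ_M, and all indices i, α: | Σ_B ( ∂Φ^B/∂F_{iα}(F) − ∂Φ^B/∂F_{iα}(F̄) ) ( (∂ê/∂ξ^B)(Φ(F),η) − (∂ê/∂ξ^B)(Φ(F̄),η̄) ) | ≤ C₁ · I(v,Φ(F),η | v̄,Φ(F̄),η̄). -/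
open scoped BigOperators
noncomputable section

theorem abs_le_frob (F : Mat) (i j : Fin 3) : |F i j| ≤ frob F := by
  refine Real.abs_le_sqrt ((Finset.single_le_sum (f := fun j => F i j ^ 2)
    (fun _ _ => sq_nonneg _) (Finset.mem_univ j)).trans ?_)
  exact Finset.single_le_sum (f := fun i => ∑ j, F i j ^ 2)
    (fun _ _ => Finset.sum_nonneg fun _ _ => sq_nonneg _) (Finset.mem_univ i)

theorem abs_entry_le_norm (F : Mat) (i j : Fin 3) : |F i j| ≤ ‖F‖ :=
  (norm_le_pi_norm (F i) j).trans (norm_le_pi_norm F i)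

theorem sq_norm_le_sum_sq (d : XE) :
    ‖d‖ ^ 2 ≤ frob d.1.1 ^ 2 + frob d.1.2.1 ^ 2 + d.1.2.2 ^ 2 + d.2 ^ 2 := by
  have h1 := sq_nonneg (frob d.1.1)
  have h2 := sq_nonneg (frob d.1.2.1)
  have h3 := sq_nonneg d.1.2.2
  have h4 := sq_nonneg d.2
  refine (Real.le_sqrt (norm_nonneg d) (by positivity)).1 ?_
  refine norm_prod_le_iff.2 ⟨norm_prod_le_iff.2 ⟨?_, norm_prod_le_iff.2 ⟨?_, ?_⟩⟩, ?_⟩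
  · exact (norm_le_frob _).trans (Real.le_sqrt_of_sq_le (by linarith))
  · exact (norm_le_frob _).trans (Real.le_sqrt_of_sq_le (by linarith))
  · exact Real.abs_le_sqrt (by linarith)
  · exact Real.abs_le_sqrt (by linarith)

theorem abs_lc_le_one (i j k : Fin 3) : |lc i j k| ≤ 1 := by
  fin_cases i <;> fin_cases j <;> fin_cases k <;> norm_num [lc]

theorem abs_cof_le {F : Mat} {s : ℝ} (h : ∀ i j, |F i j| ≤ s) (i α : Fin 3) :
    |cof F i α| ≤ 81 / 2 * s ^ 2 := by
  have hs : 0 ≤ s := (abs_nonneg _).trans (h 0 0)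
  have key : |∑ j, ∑ k, ∑ β, ∑ γ, lc i j k * lc α β γ * F j β * F k γ|
      ≤ ∑ _j : Fin 3, ∑ _k : Fin 3, ∑ _β : Fin 3, ∑ _γ : Fin 3, s ^ 2 := by
    refine (Finset.abs_sum_le_sum_abs _ _).trans (Finset.sum_le_sum fun j _ => ?_)
    refine (Finset.abs_sum_le_sum_abs _ _).trans (Finset.sum_le_sum fun k _ => ?_)
    refine (Finset.abs_sum_le_sum_abs _ _).trans (Finset.sum_le_sum fun β _ => ?_)
    refine (Finset.abs_sum_le_sum_abs _ _).trans (Finset.sum_le_sum fun γ _ => ?_)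
    rw [abs_mul, abs_mul, abs_mul]
    calc |lc i j k| * |lc α β γ| * |F j β| * |F k γ| ≤ 1 * 1 * s * s := by
          gcongr <;> first | exact abs_lc_le_one _ _ _ | exact h _ _
      _ = s ^ 2 := by ring
  simp only [Finset.sum_const, Finset.card_univ, Fintype.card_fin, nsmul_eq_mul] at key
  rw [cof, abs_mul, abs_of_pos (by norm_num : (0 : ℝ) < 1 / 2)]
  push_cast at key
  linarith

theorem abs_lc_contraction_le {D E : Mat} {f z : ℝ} (hD : ∀ j β, |D j β| ≤ f)
    (hE : ∀ k γ, |E k γ| ≤ z) (i α : Fin 3) :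
    |∑ k, ∑ γ, (∑ j, ∑ β, lc i j k * lc α β γ * D j β) * E k γ| ≤ 81 * (f * z) := by
  have hf : 0 ≤ f := (abs_nonneg _).trans (hD 0 0)
  have inner (k γ : Fin 3) : |∑ j, ∑ β, lc i j k * lc α β γ * D j β| ≤ 9 * f := by
    have : |∑ j, ∑ β, lc i j k * lc α β γ * D j β| ≤ ∑ _j : Fin 3, ∑ _β : Fin 3, f := by
      refine (Finset.abs_sum_le_sum_abs _ _).trans (Finset.sum_le_sum fun j _ => ?_)
      refine (Finset.abs_sum_le_sum_abs _ _).trans (Finset.sum_le_sum fun β _ => ?_)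
      rw [abs_mul, abs_mul]
      calc |lc i j k| * |lc α β γ| * |D j β| ≤ 1 * 1 * f := by
            gcongr <;> first | exact abs_lc_le_one _ _ _ | exact hD _ _
        _ = f := by ring
    refine this.trans (le_of_eq ?_)
    simp only [Finset.sum_const, Finset.card_univ, Fintype.card_fin, nsmul_eq_mul]
    push_cast; ring
  have : |∑ k, ∑ γ, (∑ j, ∑ β, lc i j k * lc α β γ * D j β) * E k γ|
      ≤ ∑ _k : Fin 3, ∑ _γ : Fin 3, 9 * f * z := by
    refine (Finset.abs_sum_le_sum_abs _ _).trans (Finset.sum_le_sum fun k _ => ?_)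
    refine (Finset.abs_sum_le_sum_abs _ _).trans (Finset.sum_le_sum fun γ _ => ?_)
    rw [abs_mul]
    gcongr
    exacts [inner k γ, hE k γ]
  refine this.trans (le_of_eq ?_)
  simp only [Finset.sum_const, Finset.card_univ, Fintype.card_fin, nsmul_eq_mul]
  push_cast; ring

theorem isClosed_Dom : IsClosed Dom := isClosed_le continuous_const continuous_snd

theorem contDiffOn_fderivWithin_Dom {eh : XE → ℝ} (h : ContDiffOn ℝ 3 eh Dom) :
    ContDiffOn ℝ 1 (fderivWithin ℝ eh Dom) Dom :=
  h.fderivWithin uniqueDiffOn_Dom (by norm_num)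

/-- Uniform convexity bounds the relative energy below by the squared distance. -/
theorem sq_norm_le_erel {c : ℝ} {eh : XE → ℝ} (hc : 0 < c) (hC3 : ContDiffOn ℝ 3 eh Dom)
    (hconv : UnifConvex eh c) {x xb : XE} (hx : x ∈ Dom) (hxb : xb ∈ Dom) :
    c / 2 * ‖x - xb‖ ^ 2 ≤ erel eh x xb := by
  rw [erel_eq]
  set d := x - xb with hd
  set r := ‖d‖
  let γ : ℝ → XE := fun t => xb + t • d
  have hγ : ∀ t ∈ Set.Icc (0 : ℝ) 1, γ t ∈ Dom := fun t ht =>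
    convex_Dom.add_smul_sub_mem hxb hx ht
  have hγ' (t : ℝ) : HasDerivWithinAt γ d (Set.Icc 0 1) t := by
    have := (((hasDerivAt_id t).smul_const d).const_add xb).hasDerivWithinAt (s := Set.Icc 0 1)
    rwa [one_smul] at this
  have hg : ∀ t ∈ Set.Icc (0 : ℝ) 1,
      HasDerivWithinAt (fun t => eh (γ t)) (fderivWithin ℝ eh Dom (γ t) d) (Set.Icc 0 1) t :=
    fun t ht => (((hC3.differentiableOn (by norm_num)) _ (hγ t ht)).hasFDerivWithinAt
      ).comp_hasDerivWithinAt t (hγ' t) hγ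
  have hh : ∀ t ∈ Set.Icc (0 : ℝ) 1,
      HasDerivWithinAt (fun t => fderivWithin ℝ eh Dom (γ t) d) (d2 eh (γ t) d d)
        (Set.Icc 0 1) t := fun t ht => by
    have := (((contDiffOn_fderivWithin_Dom hC3).differentiableOn (by norm_num)).clm_apply
      (differentiableOn_const d)) _ (hγ t ht)
    exact this.hasFDerivWithinAt.comp_hasDerivWithinAt t (hγ' t) hγ
  have hd2 : ∀ t ∈ Set.Icc (0 : ℝ) 1, c * r ^ 2 ≤ d2 eh (γ t) d d := fun t ht =>
    (mul_le_mul_of_nonneg_left (sq_norm_le_sum_sq d) hc.le).trans (hconv _ (hγ t ht) d)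
  have mono_of {f f' : ℝ → ℝ} (hf : ∀ t ∈ Set.Icc (0 : ℝ) 1,
      HasDerivWithinAt f (f' t) (Set.Icc 0 1) t) (hf' : ∀ t ∈ Set.Icc (0 : ℝ) 1, 0 ≤ f' t) :
      MonotoneOn f (Set.Icc 0 1) :=
    monotoneOn_of_hasDerivWithinAt_nonneg (convex_Icc 0 1)
      (fun t ht => (hf t ht).continuousWithinAt)
      (fun t ht => (hf t (interior_subset ht)).mono interior_subset)
      (fun t ht => hf' t (interior_subset ht))
  have h0 : (0 : ℝ) ∈ Set.Icc (0 : ℝ) 1 := by simp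
  have h1 : (1 : ℝ) ∈ Set.Icc (0 : ℝ) 1 := by simp
  have m1 := mono_of (f := fun t => fderivWithin ℝ eh Dom (γ t) d - c * r ^ 2 * t)
    (f' := fun t => d2 eh (γ t) d d - c * r ^ 2 * 1)
    (fun t ht => (hh t ht).sub ((hasDerivWithinAt_id t _).const_mul _))
    (fun t ht => by linarith [hd2 t ht])
  have m2 := mono_of (f := fun t => eh (γ t) - fderivWithin ℝ eh Dom (γ 0) d * t
      - c * r ^ 2 / 2 * t ^ 2)
    (f' := fun t => fderivWithin ℝ eh Dom (γ t) d - fderivWithin ℝ eh Dom (γ 0) d * 1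
      - c * r ^ 2 / 2 * (2 * t))
    (fun t ht => ((hg t ht).sub ((hasDerivWithinAt_id t _).const_mul _)).sub
      (by simpa using ((hasDerivAt_pow 2 t).hasDerivWithinAt.const_mul (c * r ^ 2 / 2))))
    (fun t ht => by have := m1 h0 ht ht.1; simp only at this; linarith)
  have := m2 h0 h1 zero_le_one
  have e0 : γ 0 = xb := by simp [γ]
  have e1 : γ 1 = x := by simp [γ, hd]
  simp only [e0, e1] at this
  linarith

theorem le_rpow_of_rpow_div_le {a T m p : ℝ} (ha : 0 ≤ a) (hT : 0 ≤ T) (hm : 0 < m) (hp : 0 < p)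
    (h : a ^ (p / m) ≤ T) : a ≤ (T ^ (1 / p)) ^ m := by
  rw [← Real.rpow_mul hT, show 1 / p * m = (p / m)⁻¹ by field_simp]
  exact (Real.le_rpow_inv_iff_of_pos ha hT (by positivity)).2 h

/-- The growth conditions in terms of the scale `s`, where `s ^ p` is comparable to `1 + N`. -/
theorem exists_scale {cg p q ρ ℓ : ℝ} {eh : XE → ℝ} (hcg : 0 < cg) (hp : 4 ≤ p)
    (hG3 : GrowthG3 eh cg p q ρ ℓ) {x : XE} (hx : x ∈ Dom) :
    ∃ s : ℝ, 1 ≤ s ∧ s ^ p = (1 + cg) * (1 + bigN p q ρ ℓ x) ∧ frob x.1.1 ≤ s ∧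
      frob (dZmat eh x) ≤ s ^ (p - 2) ∧ |dW eh x| ≤ s ^ (p - 3) := by
  have hF := Real.rpow_nonneg (frob_nonneg x.1.1) p
  have hrest : 0 ≤ frob x.1.2.1 ^ q + |x.1.2.2| ^ ρ + |x.2| ^ ℓ := by
    have := frob_nonneg x.1.2.1
    positivity
  have hN : frob x.1.1 ^ p ≤ bigN p q ρ ℓ x := by unfold bigN; linarith
  have hN0 : 0 ≤ bigN p q ρ ℓ x := hF.trans hN
  have hmul : 0 ≤ cg * bigN p q ρ ℓ x := by positivity
  have h1 := Real.rpow_nonneg (frob_nonneg (dFmat eh x)) (p / (p - 1))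
  have h2 := Real.rpow_nonneg (frob_nonneg (dZmat eh x)) (p / (p - 2))
  have h3 := Real.rpow_nonneg (abs_nonneg (dW eh x)) (p / (p - 3))
  have h := hG3 x hx
  obtain ⟨T, hT⟩ : ∃ T, T = (1 + cg) * (1 + bigN p q ρ ℓ x) := ⟨_, rfl⟩
  have hT' : T = 1 + cg + bigN p q ρ ℓ x + cg * bigN p q ρ ℓ x := by rw [hT]; ring
  have hT1 : 1 ≤ T := by linarith
  have hT0 : 0 ≤ T := by linarith
  refine ⟨T ^ (1 / p), Real.one_le_rpow hT1 (by positivity), ?_, ?_, ?_, ?_⟩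
  · rw [← Real.rpow_mul hT0, one_div, inv_mul_cancel₀ (by linarith), Real.rpow_one, hT]
  · have := le_rpow_of_rpow_div_le (p := p) (frob_nonneg x.1.1) hT0 one_pos (by linarith)
      (by rw [div_one]; linarith)
    rwa [Real.rpow_one] at this
  · exact le_rpow_of_rpow_div_le (frob_nonneg _) hT0 (by linarith) (by linarith) (by linarith)
  · exact le_rpow_of_rpow_div_le (abs_nonneg _) hT0 (by linarith) (by linarith) (by linarith)

theorem abs_dZmat_sub_le (eh : XE → ℝ) (x y : XE) (k γ : Fin 3) :
    |dZmat eh x k γ - dZmat eh y k γ| ≤ ‖fderivWithin ℝ eh Dom x - fderivWithin ℝ eh Dom y‖ := by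
  have := (fderivWithin ℝ eh Dom x - fderivWithin ℝ eh Dom y).le_opNorm
    (((0 : Mat), (Pi.single k (Pi.single γ 1) : Mat), (0 : ℝ)), (0 : ℝ))
  simpa [dZmat, dXi, Prod.norm_def, Pi.norm_single] using this

theorem abs_dZmat_le (eh : XE → ℝ) (x : XE) (k γ : Fin 3) :
    |dZmat eh x k γ| ≤ ‖fderivWithin ℝ eh Dom x‖ := by
  have := (fderivWithin ℝ eh Dom x).le_opNorm
    (((0 : Mat), (Pi.single k (Pi.single γ 1) : Mat), (0 : ℝ)), (0 : ℝ))
  simpa [dZmat, dXi, Prod.norm_def, Pi.norm_single] using this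

theorem abs_dW_sub_le (eh : XE → ℝ) (x y : XE) :
    |dW eh x - dW eh y| ≤ ‖fderivWithin ℝ eh Dom x - fderivWithin ℝ eh Dom y‖ := by
  have := (fderivWithin ℝ eh Dom x - fderivWithin ℝ eh Dom y).le_opNorm
    (((0 : Mat), (0 : Mat), (1 : ℝ)), (0 : ℝ))
  simpa [dW, dXi, Prod.norm_def] using this

theorem abs_dW_le (eh : XE → ℝ) (x : XE) : |dW eh x| ≤ ‖fderivWithin ℝ eh Dom x‖ := by
  have := (fderivWithin ℝ eh Dom x).le_opNorm (((0 : Mat), (0 : Mat), (1 : ℝ)), (0 : ℝ))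
  simpa [dW, dXi, Prod.norm_def] using this

theorem exists_norm_Phi_le (M : ℝ) :
    ∃ R ≥ (0 : ℝ), ∀ (F : Mat) (vb : Fin 3 → ℝ) (η : ℝ), Gam M F vb η → ‖(Phi F, η)‖ ≤ R := by
  obtain ⟨R, hR⟩ := ((isCompact_closedBall (0 : Mat × ℝ) M).image
    (f := fun y : Mat × ℝ => ((Phi y.1, y.2) : XE))
    ((continuous_Phi.comp continuous_fst).prodMk continuous_snd)).isBounded.exists_norm_le
  refine ⟨max R 0, le_max_right _ _, fun F vb η h => (hR _ ⟨(F, η), ?_, rfl⟩).trans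
    (le_max_left _ _)⟩
  rw [mem_closedBall_zero_iff, norm_prod_le_iff]
  exact ⟨(norm_le_frob F).trans h.1, abs_le.2 ⟨by linarith [h.2.2.1, h.2.2.2], h.2.2.2⟩⟩

/-- Away from the diagonal, the relative energy controls the growth weight. -/
theorem weight_le_erel {c cg p q ρ ℓ E G : ℝ} {eh : XE → ℝ} (hc : 0 < c) (hcg : 0 < cg)
    (hC3 : ContDiffOn ℝ 3 eh Dom) (hconv : UnifConvex eh c) (hG1 : GrowthG1 eh cg p q ρ ℓ)
    {x xb : XE} (hx : x ∈ Dom) (hxb : xb ∈ Dom) (hE : |eh xb| ≤ E)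
    (hG : ‖fderivWithin ℝ eh Dom xb‖ ≤ G) (hr : 1 ≤ ‖x - xb‖) :
    (1 + cg) * (1 + bigN p q ρ ℓ x)
      ≤ (1 + cg) * (1 + (E + G + 2 * cg) * (2 / c)) / cg * erel eh x xb := by
  have hconvex := sq_norm_le_erel hc hC3 hconv hx hxb
  have hlow := (hG1 x hx).1
  have heq := erel_eq eh x xb
  set r := ‖x - xb‖
  have hG0 : 0 ≤ G := (norm_nonneg _).trans hG
  have hE0 : 0 ≤ E := (abs_nonneg _).trans hE
  have hlin : |fderivWithin ℝ eh Dom xb (x - xb)| ≤ G * r :=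
    ((fderivWithin ℝ eh Dom xb).le_opNorm _).trans (by gcongr)
  have hrr : r ≤ r ^ 2 := by nlinarith
  have hr2 : r ^ 2 ≤ 2 / c * erel eh x xb := by
    calc r ^ 2 = 2 / c * (c / 2 * r ^ 2) := by field_simp
      _ ≤ _ := by gcongr
  have hN : cg * (1 + bigN p q ρ ℓ x) ≤ erel eh x xb + (E + G + 2 * cg) * r ^ 2 := by
    have h1 := mul_le_mul_of_nonneg_left hrr hG0
    have h2 := mul_le_mul_of_nonneg_left (hr.trans hrr) hE0
    have h3 := mul_le_mul_of_nonneg_left (hr.trans hrr) hcg.le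
    linarith [le_abs_self (eh xb), le_abs_self (fderivWithin ℝ eh Dom xb (x - xb))]
  have hN' : cg * (1 + bigN p q ρ ℓ x) ≤ (1 + (E + G + 2 * cg) * (2 / c)) * erel eh x xb := by
    have := mul_le_mul_of_nonneg_left hr2 (by positivity : 0 ≤ E + G + 2 * cg)
    linarith
  calc (1 + cg) * (1 + bigN p q ρ ℓ x)
      = (1 + cg) / cg * (cg * (1 + bigN p q ρ ℓ x)) := by field_simp
    _ ≤ (1 + cg) / cg * ((1 + (E + G + 2 * cg) * (2 / c)) * erel eh x xb) := by gcongr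
    _ = _ := by ring

/-- The sum of the cofactor and determinant blocks of the cross term. -/
theorem abs_cross_term_le {D E : Mat} {f z g w a b : ℝ} (hD : ∀ j β, |D j β| ≤ f)
    (hE : ∀ k γ, |E k γ| ≤ z) (ha : |a| ≤ g) (hb : |b| ≤ w) (i α : Fin 3) :
    |(∑ k, ∑ γ, (∑ j, ∑ β, lc i j k * lc α β γ * D j β) * E k γ) + a * b|
      ≤ 81 * (f * z) + g * w := by
  refine (abs_add_le _ _).trans (add_le_add (abs_lc_contraction_le hD hE i α) ?_)
  rw [abs_mul]
  exact mul_le_mul ha hb (abs_nonneg _) ((abs_nonneg _).trans ha)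

/-- relative entropy estimate, part (II): stress–null-Lagrangian
cross term.  Under uniform convexity and (G1)–(G3), for every `M > 0` there is
`C₁ > 0` such that for all `(F,v,η)` and `(F̄,v̄,η̄) ∈ Γ_M` and all `i,α`:
`|Σ_B (∂Φ^B/∂F_{iα}(F) − ∂Φ^B/∂F_{iα}(F̄))((∂eh/∂ξ^B)(Φ(F),η) − (∂eh/∂ξ^B)(Φ(F̄),η̄))|
  ≤ C₁ I(v,Φ(F),η|v̄,Φ(F̄),η̄)`  (the sum over `B` written out over the three blocks
`F`, `cof`, `det` of the null-Lagrangian vector). -/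
theorem relative_entropy_cross_term_bound
    (c cg p q ρ ℓ : ℝ) (eh : XE → ℝ)
    (hc : 0 < c) (hcg : 0 < cg)
    (hp : 4 ≤ p) (hq : 2 ≤ q) (hρ : 1 < ρ) (hℓ : 1 < ℓ)
    (hC3 : ContDiffOn ℝ 3 eh Dom)
    (hconv : UnifConvex eh c)
    (hG1 : GrowthG1 eh cg p q ρ ℓ)
    (hG2 : GrowthG2 eh p q ρ ℓ)
    (hG3 : GrowthG3 eh cg p q ρ ℓ)
    :
    ∀ M > (0:ℝ), ∃ C₁ > (0:ℝ),
      ∀ (F Fb : Mat) (v vb : Fin 3 → ℝ) (η ηb : ℝ),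
        0 ≤ η → Gam M Fb vb ηb → ∀ i α : Fin 3,
        |(∑ j, ∑ β,
            ((if j = i then (1:ℝ) else 0) * (if β = α then (1:ℝ) else 0)
              - (if j = i then (1:ℝ) else 0) * (if β = α then (1:ℝ) else 0))
            * (dFmat eh (Phi F, η) j β - dFmat eh (Phi Fb, ηb) j β))
          + (∑ k, ∑ γ,
            (∑ j, ∑ β, lc i j k * lc α β γ * (F j β - Fb j β))
              * (dZmat eh (Phi F, η) k γ - dZmat eh (Phi Fb, ηb) k γ))
          + (cof F i α - cof Fb i α) * (dW eh (Phi F, η) - dW eh (Phi Fb, ηb))|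
          ≤ C₁ * relI eh v vb (Phi F, η) (Phi Fb, ηb) := by
  intro M _
  obtain ⟨R, hR0, hR⟩ := exists_norm_Phi_le M
  have hK : IsCompact (Dom ∩ Metric.closedBall (0 : XE) (R + 1)) :=
    (isCompact_closedBall _ _).inter_left isClosed_Dom
  have hgrad := contDiffOn_fderivWithin_Dom hC3
  obtain ⟨L, hL⟩ := (hgrad.mono Set.inter_subset_left).exists_lipschitzOnWith one_ne_zero
    (convex_Dom.inter (convex_closedBall 0 (R + 1))) hK
  obtain ⟨G, hG⟩ := hK.exists_bound_of_continuousOn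
    (hgrad.continuousOn.mono Set.inter_subset_left)
  obtain ⟨E, hE⟩ := hK.exists_bound_of_continuousOn
    (hC3.continuousOn.mono Set.inter_subset_left)
  have h0K : (0 : XE) ∈ Dom ∩ Metric.closedBall (0 : XE) (R + 1) :=
    ⟨le_refl (0 : ℝ), Metric.mem_closedBall_self (by linarith)⟩
  have hG0 : 0 ≤ G := (norm_nonneg _).trans (hG 0 h0K)
  have hE0 : 0 ≤ E := (norm_nonneg _).trans (hE 0 h0K)
  set A := (1 + cg) * (1 + (E + G + 2 * cg) * (2 / c)) / cg with hA
  set B := (122 + 82 * R) * (1 + G) with hB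
  have hA0 : 0 < A := by positivity
  have hB0 : 0 < B := by positivity
  refine ⟨82 * L * (2 / c) + B * A, by positivity, ?_⟩
  intro F Fb v vb η ηb hη hΓ i α
  have hx : ((Phi F, η) : XE) ∈ Dom := hη
  have hxb : ((Phi Fb, ηb) : XE) ∈ Dom := hΓ.2.2.1
  have hxbR := hR Fb vb ηb hΓ
  set x : XE := (Phi F, η) with hxdef
  set xb : XE := (Phi Fb, ηb) with hxbdef
  have hxbK : xb ∈ Dom ∩ Metric.closedBall (0 : XE) (R + 1) :=
    ⟨hxb, by rw [mem_closedBall_zero_iff]; linarith⟩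
  have hconvex := sq_norm_le_erel hc hC3 hconv hx hxb
  have herel : 0 ≤ erel eh x xb := le_trans (by positivity) hconvex
  have hI : erel eh x xb ≤ relI eh v vb x xb := by
    have : 0 ≤ ∑ i, (v i - vb i) ^ 2 := Finset.sum_nonneg fun _ _ => sq_nonneg _
    unfold relI
    linarith
  have hD1 : ‖F - Fb‖ ≤ ‖x - xb‖ := (norm_fst_le (x - xb).1).trans (norm_fst_le (x - xb))
  have hD2 : ‖cof F - cof Fb‖ ≤ ‖x - xb‖ :=
    ((norm_fst_le (x - xb).1.2).trans (norm_snd_le (x - xb).1)).trans (norm_fst_le (x - xb))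
  have hFb : ‖Fb‖ ≤ R := ((norm_fst_le xb.1).trans (norm_fst_le xb)).trans hxbR
  have hcofb : ‖cof Fb‖ ≤ R :=
    (((norm_fst_le xb.1.2).trans (norm_snd_le xb.1)).trans (norm_fst_le xb)).trans hxbR
  simp only [sub_self, zero_mul, Finset.sum_const_zero, zero_add]
  refine le_trans ?_ (mul_le_mul_of_nonneg_left hI (by positivity))
  rcases le_total ‖x - xb‖ 1 with hr | hr
  · have hxK : x ∈ Dom ∩ Metric.closedBall (0 : XE) (R + 1) := by
      refine ⟨hx, ?_⟩
      rw [mem_closedBall_zero_iff]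
      linarith [norm_le_norm_add_norm_sub' x xb]
    have hlip := hL.norm_sub_le hxK hxbK
    have hcross := abs_cross_term_le (D := F - Fb) (E := dZmat eh x - dZmat eh xb)
      (fun j β => (abs_entry_le_norm (F - Fb) j β).trans hD1)
      (fun k γ => (abs_dZmat_sub_le eh x xb k γ).trans hlip)
      ((abs_entry_le_norm (cof F - cof Fb) i α).trans hD2)
      ((abs_dW_sub_le eh x xb).trans hlip) i α
    refine hcross.trans ?_
    calc 81 * (‖x - xb‖ * (L * ‖x - xb‖)) + ‖x - xb‖ * (L * ‖x - xb‖)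
        = 82 * L * (2 / c) * (c / 2 * ‖x - xb‖ ^ 2) := by field_simp; ring
      _ ≤ 82 * L * (2 / c) * erel eh x xb := by gcongr
      _ ≤ _ := by
        gcongr
        exact le_add_of_nonneg_right (by positivity)
  · have hweight := weight_le_erel hc hcg hC3 hconv hG1 hx hxb (hE xb hxbK) (hG xb hxbK) hr
    obtain ⟨s, hs1, hsp, hsF, hsZ, hsW⟩ := exists_scale hcg hp hG3 hx
    have hs0 : 0 < s := by linarith
    have hF (j β : Fin 3) : |F j β| ≤ s := (abs_le_frob F j β).trans hsF
    have hs2 : 1 ≤ s ^ 2 := one_le_pow₀ hs1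
    have hsp2 : 1 ≤ s ^ (p - 2) := Real.one_le_rpow hs1 (by linarith)
    have hsp3 : 1 ≤ s ^ (p - 3) := Real.one_le_rpow hs1 (by linarith)
    have hcross := abs_cross_term_le (D := F - Fb) (E := dZmat eh x - dZmat eh xb)
      (f := (1 + R) * s) (z := (1 + G) * s ^ (p - 2)) (g := (41 + R) * s ^ 2)
      (w := (1 + G) * s ^ (p - 3)) (a := cof F i α - cof Fb i α) (b := dW eh x - dW eh xb)
      (fun j β => by
        have h1 := abs_sub (F j β) (Fb j β)
        have h2 := (abs_entry_le_norm Fb j β).trans hFb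
        have h3 := mul_le_mul_of_nonneg_left hs1 hR0
        simp only [Pi.sub_apply]
        linarith [hF j β])
      (fun k γ => by
        have h1 := abs_sub (dZmat eh x k γ) (dZmat eh xb k γ)
        have h2 := (abs_dZmat_le eh xb k γ).trans (hG xb hxbK)
        have h3 := mul_le_mul_of_nonneg_left hsp2 hG0
        simp only [Pi.sub_apply]
        linarith [(abs_le_frob (dZmat eh x) k γ).trans hsZ])
      (by
        have h1 := abs_sub (cof F i α) (cof Fb i α)
        have h2 := (abs_entry_le_norm (cof Fb) i α).trans hcofb
        have h3 := mul_le_mul_of_nonneg_left hs2 hR0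
        linarith [abs_cof_le hF i α])
      (by
        have h1 := abs_sub (dW eh x) (dW eh xb)
        have h2 := (abs_dW_le eh xb).trans (hG xb hxbK)
        have h3 := mul_le_mul_of_nonneg_left hsp3 hG0
        linarith) i α
    have e1 : s * s ^ (p - 2) = s ^ (p - 1) := by
      rw [← Real.rpow_one_add' hs0.le (by linarith)]
      ring_nf
    have e2 : s ^ 2 * s ^ (p - 3) = s ^ (p - 1) := by
      rw [← Real.rpow_natCast s 2, ← Real.rpow_add hs0]
      push_cast
      ring_nf
    refine hcross.trans ?_
    calc 81 * ((1 + R) * s * ((1 + G) * s ^ (p - 2)))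
          + (41 + R) * s ^ 2 * ((1 + G) * s ^ (p - 3))
        = 81 * (1 + R) * (1 + G) * (s * s ^ (p - 2))
          + (41 + R) * (1 + G) * (s ^ 2 * s ^ (p - 3)) := by ring
      _ = B * s ^ (p - 1) := by rw [e1, e2, hB]; ring
      _ ≤ B * s ^ p := by gcongr; linarith
      _ ≤ B * (A * erel eh x xb) := by rw [hsp]; gcongr
      _ = B * A * erel eh x xb := by ring
      _ ≤ _ := by
        gcongr
        exact le_add_of_nonneg_left (by positivity)
end
end
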